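/- If 0 < p < q < 1/2 and ε_d ∈ (0,1), then for every sequence of key sizes Δ(n), every achievable relative throughput r satisfies r ≤ t(q,ε_d) · I_B(p,q); that is, the covert capacity r*_{Δ(n),ε_d}(p,q) ≤ t(q,ε_d) · I_B(p,q). -/

import Mathlib

/-!
Covert communication over an adversarially jammed binary channel.

A code with blocklength `n`, `N` messages and `Δ` key bits consists of an
encoder `Fin N → key → {0,1}^n` and a decoder `{0,1}^n → key → {0,…,N}`
(we model the output `0` ("declare silence") as `Option.none`).
When Alice is silent she transmits the all-zeros vector.
James observes `Z = X ⊕ S̄` with `S̄` i.i.d. Bernoulli(q); a jamming strategy is a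
stochastic kernel from observations `z` to jamming vectors `s` of Hamming
weight at most `p·n`.  Bob receives `Y = X ⊕ S`.
-/

namespace CovertComm

open Finset Filter

/-- Binary vectors of length `n`. -/
abbrev BV (n : ℕ) := Fin n → Bool

/-- Coordinatewise XOR of binary vectors. -/
def vxor {n : ℕ} (x y : BV n) : BV n := fun i => Bool.xor (x i) (y i)

/-- Hamming weight. -/
def wt {n : ℕ} (x : BV n) : ℕ := (Finset.univ.filter fun i => x i = true).card

/-- Probability that an i.i.d. Bernoulli(q) noise vector equals `z`. -/
noncomputable def noiseP {n : ℕ} (q : ℝ) (z : BV n) : ℝ :=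
  ∏ i, if z i then q else 1 - q

/-- A code: encoder and decoder.  Decoder output `none` means "declare 0 (silence)". -/
structure Code (n N Δ : ℕ) where
  enc : Fin N → BV Δ → BV n
  dec : BV n → BV Δ → Option (Fin N)

/-- A jamming strategy: a stochastic kernel `W z s`, supported on jamming
vectors of Hamming weight at most `p·n`. -/
structure Jammer (n : ℕ) (p : ℝ) where
  W : BV n → BV n → ℝ
  nonneg : ∀ z s, 0 ≤ W z s
  sum_one : ∀ z, ∑ s : BV n, W z s = 1
  wt_le : ∀ z s, W z s ≠ 0 → (wt s : ℝ) ≤ p * n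

/-- False-alarm probability of detector `Φ`: when `T = 0`, `Z` is pure
Bernoulli(q) noise. -/
noncomputable def PFA {n : ℕ} (q : ℝ) (Φ : BV n → Bool) : ℝ :=
  ∑ z : BV n, noiseP q z * (if Φ z then (1 : ℝ) else 0)

/-- Missed-detection probability of detector `Φ`: when `T = 1`, the message and
key are uniform and `Z = Enc(M,K) ⊕ S̄`. -/
noncomputable def PMD {n N Δ : ℕ} (q : ℝ) (C : Code n N Δ) (Φ : BV n → Bool) : ℝ :=
  (1 / ((N : ℝ) * 2 ^ Δ)) * ∑ m : Fin N, ∑ k : BV Δ, ∑ z : BV n,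
    noiseP q (vxor z (C.enc m k)) * (if Φ z then (0 : ℝ) else 1)

/-- Probability of decoding error when Alice is active:
`P(Dec(Enc(M,K) ⊕ S, K) ≠ M | T = 1)` with uniform `M, K`, where
`S` is drawn from `J.W` applied to James' observation `Enc(M,K) ⊕ S̄`. -/
noncomputable def errActive {n N Δ : ℕ} {p : ℝ} (q : ℝ) (C : Code n N Δ)
    (J : Jammer n p) : ℝ :=
  (1 / ((N : ℝ) * 2 ^ Δ)) * ∑ m : Fin N, ∑ k : BV Δ, ∑ zb : BV n,
    noiseP q zb * ∑ s : BV n, J.W (vxor (C.enc m k) zb) s *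
      (if C.dec (vxor (C.enc m k) s) k = some m then (0 : ℝ) else 1)

/-- Probability of decoding error when Alice is silent:
`P(Dec(S, K) ≠ 0 | T = 0)`, where `S` is drawn from `J.W` applied to the pure
noise observation. -/
noncomputable def errSilent {n N Δ : ℕ} {p : ℝ} (q : ℝ) (C : Code n N Δ)
    (J : Jammer n p) : ℝ :=
  (1 / (2 ^ Δ : ℝ)) * ∑ k : BV Δ, ∑ zb : BV n,
    noiseP q zb * ∑ s : BV n, J.W zb s *
      (if C.dec s k = Option.none then (0 : ℝ) else 1)

/-- `P_err`: worst case over jamming strategies of the sum of the two error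
probabilities. -/
noncomputable def Perr {n N Δ : ℕ} (p q : ℝ) (C : Code n N Δ) : ℝ :=
  ⨆ J : Jammer n p, (errSilent q C J + errActive q C J)

/-- `min_Φ (P_FA(Φ) + P_MD(Φ))` for a given code. -/
noncomputable def covertGap {n N Δ : ℕ} (q : ℝ) (C : Code n N Δ) : ℝ :=
  ⨅ Φ : BV n → Bool, (PFA q Φ + PMD q C Φ)

/-- A sequence of codes is `(1 − εd)`-covert if
`liminf_n min_Φ (P_FA + P_MD) ≥ 1 − εd`. -/
def IsCovertSeq (q εd : ℝ) (N Δ : ℕ → ℕ) (C : ∀ n, Code n (N n) (Δ n)) : Prop :=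
  1 - εd ≤ Filter.liminf (fun n => covertGap q (C n)) Filter.atTop

/-- Relative throughput `r` is achievable with key sizes `Δ(n)`: there is a
`(1 − εd)`-covert sequence of codes with `Δ(n)` key bits, relative throughput
at least `r` at every (positive) blocklength, and `P_err → 0`. -/
def Achievable (p q εd : ℝ) (Δ : ℕ → ℕ) (r : ℝ) : Prop :=
  ∃ (N : ℕ → ℕ) (C : ∀ n, Code n (N n) (Δ n)),
    IsCovertSeq q εd N Δ C ∧
    (∀ n : ℕ, 1 ≤ n → r ≤ Real.logb 2 (N n) / Real.sqrt n) ∧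
    Filter.Tendsto (fun n => Perr p q (C n)) Filter.atTop (nhds 0)

/-- The Gaussian `Q`-function. -/
noncomputable def Qfun (x : ℝ) : ℝ :=
  ∫ u in Set.Ioi x, Real.exp (-u ^ 2 / 2) / Real.sqrt (2 * Real.pi)

/-- Inverse of the `Q`-function. -/
noncomputable def Qinv : ℝ → ℝ := Function.invFun Qfun

/-- The code-weight parameter `t(q, εd)`. -/
noncomputable def tpar (q εd : ℝ) : ℝ :=
  2 * Real.sqrt (q * (1 - q)) / (1 - 2 * q) * Qinv ((1 - εd) / 2)

/-- Weight-normalized mutual information for Bob, `I_B(p,q)`. -/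
noncomputable def IB (p q : ℝ) : ℝ :=
  p * (q - 1) / q *
      Real.logb 2 ((q - p + p * q) * (1 - p) / (p ^ 2 * (1 - q)))
    + Real.logb 2 ((q - p + p * q) / (p * q))

/-- Weight-normalized mutual information for James, `I_J(q)`. -/
noncomputable def IJ (q : ℝ) : ℝ := (1 - 2 * q) * Real.logb 2 ((1 - q) / q)

end CovertComm

namespace CovertComm

open Finset Filter Topology MeasureTheory ProbabilityTheory

section
variable {n : ℕ}

/-- Product weight of a binary vector under independent, coordinate-dependent weights. -/
noncomputable def prodW (P : Fin n → Bool → ℝ) (z : BV n) : ℝ := ∏ i, P i (z i)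

/-- Probability of an event under a product weight. -/
noncomputable def prob (P : Fin n → Bool → ℝ) (E : BV n → Prop) : ℝ :=
  open Classical in ∑ z, if E z then prodW P z else 0

/-- Bernoulli weight. -/
noncomputable def bern (r : ℝ) (b : Bool) : ℝ := if b then r else 1 - r

lemma bern_nonneg {r : ℝ} (h0 : 0 ≤ r) (h1 : r ≤ 1) (b : Bool) : 0 ≤ bern r b := by
  cases b <;> simp [bern, h0, h1]

lemma sum_bern (r : ℝ) : ∑ b, bern r b = 1 := by simp [bern]

lemma noiseP_eq_prodW (q : ℝ) (z : BV n) : noiseP q z = prodW (fun _ => bern q) z := rfl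

lemma sum_prodW (F : Fin n → Bool → ℝ) : ∑ z : BV n, prodW F z = ∏ i, ∑ b, F i b := by
  simp only [prodW, Finset.prod_univ_sum, Fintype.piFinset_univ]

lemma prodW_nonneg {P : Fin n → Bool → ℝ} (hP : ∀ i b, 0 ≤ P i b) (z : BV n) :
    0 ≤ prodW P z := Finset.prod_nonneg fun i _ => hP i (z i)

lemma sum_prodW_eq_one {P : Fin n → Bool → ℝ} (h1 : ∀ i, ∑ b, P i b = 1) :
    ∑ z, prodW P z = 1 := by
  rw [sum_prodW]; exact Finset.prod_eq_one fun i _ => h1 i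

lemma prob_mono {P : Fin n → Bool → ℝ} (hP : ∀ i b, 0 ≤ P i b) {E F : BV n → Prop}
    (h : ∀ z, E z → F z) : prob P E ≤ prob P F := by
  refine Finset.sum_le_sum fun z _ => ?_
  have := prodW_nonneg hP z
  by_cases hE : E z
  · simp [hE, h z hE]
  · rw [if_neg hE]; split_ifs <;> simp [this]

lemma prob_le_add {P : Fin n → Bool → ℝ} (hP : ∀ i b, 0 ≤ P i b) {E F G : BV n → Prop}
    (h : ∀ z, E z → F z ∨ G z) : prob P E ≤ prob P F + prob P G := by
  simp only [prob]
  rw [← Finset.sum_add_distrib]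
  refine Finset.sum_le_sum fun z _ => ?_
  have := prodW_nonneg hP z
  by_cases hE : E z
  · rcases h z hE with hF | hG
    · simp only [hE, hF, if_true]; split_ifs <;> linarith
    · simp only [hE, hG, if_true]; split_ifs <;> linarith
  · rw [if_neg hE]; split_ifs <;> linarith

lemma prob_le_one {P : Fin n → Bool → ℝ} (hP : ∀ i b, 0 ≤ P i b)
    (h1 : ∀ i, ∑ b, P i b = 1) (E : BV n → Prop) : prob P E ≤ 1 := by
  rw [← sum_prodW_eq_one h1]
  refine Finset.sum_le_sum fun z _ => ?_
  have := prodW_nonneg hP z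
  split_ifs <;> linarith

lemma prodW_mul_mul (P f : Fin n → Bool → ℝ) (i j : Fin n) (z : BV n) :
    prodW P z * (f i (z i) * f j (z j)) =
      prodW (fun k b => P k b * ((if k = i then f k b else 1) * (if k = j then f k b else 1))) z := by
  simp only [prodW, Finset.prod_mul_distrib, Finset.prod_ite_eq', Finset.mem_univ, if_true]

lemma sum_prodW_mul_sq {P f : Fin n → Bool → ℝ} (h1 : ∀ i, ∑ b, P i b = 1)
    (h0 : ∀ i, ∑ b, P i b * f i b = 0) :
    ∑ z : BV n, prodW P z * (∑ i, f i (z i)) ^ 2 = ∑ i, ∑ b, P i b * f i b ^ 2 := by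
  have key : ∀ i j, ∑ z : BV n, prodW P z * (f i (z i) * f j (z j)) =
      if i = j then ∑ b, P i b * f i b ^ 2 else 0 := by
    intro i j
    simp only [prodW_mul_mul]
    rw [sum_prodW]
    split_ifs with hij
    · subst hij
      rw [Finset.prod_eq_single i]
      · simp [sq]
      · intro k _ hk; simpa [hk] using h1 k
      · simp
    · refine Finset.prod_eq_zero (Finset.mem_univ i) ?_
      simpa [hij] using h0 i
  have hsq : ∀ z : BV n, prodW P z * (∑ i, f i (z i)) ^ 2 =
      ∑ i, ∑ j, prodW P z * (f i (z i) * f j (z j)) := by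
    intro z
    rw [sq, Finset.sum_mul_sum]
    simp only [Finset.mul_sum]
  simp only [hsq]
  rw [Finset.sum_comm]
  refine Finset.sum_congr rfl fun i _ => ?_
  rw [Finset.sum_comm]
  simp [key]

/-- One-sided Chebyshev bound for sums of independent centered variables. -/
lemma prob_lt_sum_le {P f : Fin n → Bool → ℝ} (hP : ∀ i b, 0 ≤ P i b)
    (h1 : ∀ i, ∑ b, P i b = 1) (h0 : ∀ i, ∑ b, P i b * f i b = 0) {a V : ℝ} (ha : 0 < a)
    (hV : ∑ i, ∑ b, P i b * f i b ^ 2 ≤ V) :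
    prob P (fun z => a < ∑ i, f i (z i)) ≤ V / a ^ 2 := by
  rw [le_div_iff₀ (by positivity)]
  refine le_trans ?_ hV
  rw [← sum_prodW_mul_sq h1 h0, prob, Finset.sum_mul]
  refine Finset.sum_le_sum fun z _ => ?_
  have := prodW_nonneg hP z
  split_ifs with h
  · gcongr
  · rw [zero_mul]; positivity

lemma vxor_vxor (x y : BV n) : vxor x (vxor x y) = y := by
  funext i; simp [vxor]

lemma vxor_comm (x y : BV n) : vxor x y = vxor y x := by
  funext i; simp [vxor, Bool.xor_comm]

/-- Translation by a fixed vector, as a permutation. -/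
def vxorEquiv (x : BV n) : BV n ≃ BV n where
  toFun := vxor x
  invFun := vxor x
  left_inv := vxor_vxor x
  right_inv := vxor_vxor x

lemma sum_vxor (x : BV n) (g : BV n → ℝ) : ∑ z, g (vxor x z) = ∑ z, g z :=
  (vxorEquiv x).sum_comp g

lemma wt_eq_sum (z : BV n) : (wt z : ℝ) = ∑ i, if z i then (1 : ℝ) else 0 := by
  simp [wt]

/-! ### The central limit theorem for Bernoulli noise -/

/-- The standardized value of a Bernoulli(q) bit. -/
noncomputable def stdBit (q : ℝ) (b : Bool) : ℝ :=
  ((if b then (1 : ℝ) else 0) - q) / √(q * (1 - q))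

/-- The Bernoulli(q) measure on `Bool`. -/
noncomputable def bernMeasure (q : ℝ) : Measure Bool :=
  ENNReal.ofReal q • Measure.dirac true + ENNReal.ofReal (1 - q) • Measure.dirac false

lemma isProbabilityMeasure_bernMeasure {q : ℝ} (h0 : 0 < q) (h1 : q < 1) :
    IsProbabilityMeasure (bernMeasure q) := by
  constructor
  simp only [bernMeasure, Measure.add_apply, Measure.smul_apply, measure_univ, smul_eq_mul, mul_one]
  rw [← ENNReal.ofReal_add h0.le (by linarith)]
  simp

lemma bernMeasure_singleton {q : ℝ} (b : Bool) :
    bernMeasure q {b} = ENNReal.ofReal (bern q b) := by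
  cases b <;> simp [bernMeasure, bern]

lemma integral_bernMeasure {q : ℝ} (h0 : 0 < q) (h1 : q < 1) (f : Bool → ℝ) :
    ∫ b, f b ∂(bernMeasure q) = q * f true + (1 - q) * f false := by
  have := isProbabilityMeasure_bernMeasure h0 h1
  rw [integral_fintype (Integrable.of_finite)]
  simp [Measure.real, bernMeasure_singleton, bern, h0.le, h1.le]

/-- The event that the standardized noise weight lies in `E` has asymptotically Gaussian
probability. -/
lemma tendsto_prob_stdBit {q : ℝ} (h0 : 0 < q) (h1 : q < 1) {E : Set ℝ} (hE : MeasurableSet E)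
    (hfr : gaussianReal 0 1 (frontier E) = 0) :
    Tendsto (fun n : ℕ => prob (fun _ : Fin n => bern q)
      (fun z => (√n)⁻¹ * ∑ i, stdBit q (z i) ∈ E)) atTop (𝓝 ((gaussianReal 0 1).real E)) := by
  have := isProbabilityMeasure_bernMeasure h0 h1
  set P : Measure (ℕ → Bool) := Measure.infinitePi (fun _ => bernMeasure q) with hPdef
  set X : ℕ → (ℕ → Bool) → ℝ := fun i ω => stdBit q (ω i) with hX
  have hs : 0 < q * (1 - q) := mul_pos h0 (by linarith)
  have hmeas : Measurable (stdBit q) := measurable_of_finite _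
  have hXm : ∀ i, Measurable (X i) := fun i => hmeas.comp (measurable_pi_apply i)
  have hmap : ∀ i, P.map (fun ω => ω i) = bernMeasure q := fun i =>
    Measure.infinitePi_map_eval (μ := fun _ => bernMeasure q) i
  have hint : ∀ g : Bool → ℝ, ∫ ω, g (ω 0) ∂P = q * g true + (1 - q) * g false := by
    intro g
    rw [← integral_bernMeasure h0 h1, ← hmap 0,
      integral_map (measurable_pi_apply 0).aemeasurable]
    exact (measurable_of_finite g).aestronglyMeasurable
  have hY : HasLaw (id : ℝ → ℝ) (gaussianReal 0 1) (gaussianReal 0 1) := HasLaw.id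
  have clt := tendstoInDistribution_inv_sqrt_mul_sum (X := X) (P := P) hY
    (by
      have := hint (stdBit q)
      rw [show P[X 0] = ∫ ω, stdBit q (ω 0) ∂P from rfl, this]
      simp [stdBit]; ring)
    (by
      have := hint (fun b => stdBit q b ^ 2)
      rw [show P[X 0 ^ 2] = ∫ ω, stdBit q (ω 0) ^ 2 ∂P from rfl, this]
      simp only [stdBit, div_pow, Real.sq_sqrt hs.le]
      have : (1 - q) ≠ 0 := by linarith
      simp
      field_simp
      ring)
    (iIndepFun_infinitePi (P := fun _ : ℕ => bernMeasure q) (X := fun _ => stdBit q) (fun _ => hmeas))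
    (fun i => by
      refine ⟨(hXm i).aemeasurable, (hXm 0).aemeasurable, ?_⟩
      rw [show X i = stdBit q ∘ (fun ω => ω i) from rfl, show X 0 = stdBit q ∘ (fun ω => ω 0) from rfl,
        ← Measure.map_map hmeas (measurable_pi_apply i),
        ← Measure.map_map hmeas (measurable_pi_apply 0), hmap, hmap])
  have lim := ProbabilityMeasure.tendsto_measure_of_null_frontier_of_tendsto' clt.tendsto (E := E)
    (by simpa using hfr)
  have lim' := (ENNReal.tendsto_toReal (show Measure.map id (gaussianReal 0 1) E ≠ ⊤ by simp)).comp lim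
  have hlim : (gaussianReal 0 1).real E = ((Measure.map id (gaussianReal 0 1)) E).toReal := by
    simp [Measure.real]
  rw [hlim]
  refine lim'.congr fun n => ?_
  simp only [Function.comp_apply, ProbabilityMeasure.coe_mk]
  have hm : Measurable (fun ω : ℕ → Bool => (√(n : ℝ))⁻¹ * ∑ k ∈ Finset.range n, X k ω) := by
    fun_prop
  rw [Measure.map_apply hm hE]
  set r : (ℕ → Bool) → BV n := fun ω i => ω i with hr
  have hrm : Measurable r := by fun_prop
  have hpre : (fun ω : ℕ → Bool => (√(n : ℝ))⁻¹ * ∑ k ∈ Finset.range n, X k ω) ⁻¹' E =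
      r ⁻¹' {z : BV n | (√(n : ℝ))⁻¹ * ∑ i, stdBit q (z i) ∈ E} := by
    ext ω
    simp only [Set.mem_preimage, Set.mem_ofPred_eq, hX, hr, Finset.sum_range]
  rw [hpre, ← Measure.map_apply hrm (Set.toFinite _).measurableSet]
  have hsing : ∀ z : BV n, (P.map r) {z} = ENNReal.ofReal (prodW (fun _ => bern q) z) := by
    intro z
    rw [Measure.map_apply hrm (measurableSet_singleton _)]
    have : r ⁻¹' {z} = Set.pi (Finset.range n)
        (fun k => if h : k < n then {z ⟨k, h⟩} else Set.univ) := by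
      ext ω
      simp only [Set.mem_preimage, Set.mem_singleton_iff, Set.mem_pi, Finset.mem_coe,
        Finset.mem_range, hr]
      constructor
      · rintro rfl k hk
        simp [hk]
      · intro h
        funext i
        simpa using h i i.2
    rw [this, hPdef, Measure.infinitePi_pi _ (fun i _ => (Set.toFinite _).measurableSet),
      Finset.prod_range, prodW, ENNReal.ofReal_prod_of_nonneg]
    · refine Finset.prod_congr rfl fun i _ => ?_
      simp [bernMeasure_singleton]
    · exact fun i _ => bern_nonneg h0.le h1.le _
  have : IsProbabilityMeasure (P.map r) := Measure.isProbabilityMeasure_map hrm.aemeasurable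
  classical
  rw [show ({z : BV n | (√(n : ℝ))⁻¹ * ∑ i, stdBit q (z i) ∈ E} : Set (BV n)) =
    ((univ.filter fun z : BV n => (√(n : ℝ))⁻¹ * ∑ i, stdBit q (z i) ∈ E : Finset (BV n)) : Set (BV n))
    by simp]
  rw [← sum_measure_singleton, ENNReal.toReal_sum (fun _ _ => measure_ne_top _ _), Finset.sum_filter,
    prob]
  refine Finset.sum_congr rfl fun z _ => ?_
  rw [hsing, ENNReal.toReal_ofReal (prodW_nonneg (fun _ => bern_nonneg h0.le h1.le) z)]

/-! ### The Gaussian tail function -/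

lemma Qfun_eq_real (x : ℝ) : Qfun x = (gaussianReal 0 1).real (Set.Ioi x) := by
  rw [Measure.real, gaussianReal_apply_eq_integral 0 one_ne_zero,
    ENNReal.toReal_ofReal (setIntegral_nonneg measurableSet_Ioi
      fun _ _ => gaussianPDFReal_nonneg _ _ _), Qfun]
  refine setIntegral_congr_fun measurableSet_Ioi fun u _ => ?_
  simp [gaussianPDFReal, div_eq_inv_mul]

lemma integrable_Qfun_density :
    Integrable (fun u : ℝ => Real.exp (-u ^ 2 / 2) / √(2 * Real.pi)) := by
  convert integrable_gaussianPDFReal 0 1 using 2 with u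
  simp [gaussianPDFReal, div_eq_inv_mul]

lemma Qfun_sub_Qfun (x y : ℝ) :
    Qfun x - Qfun y = ∫ u in x..y, Real.exp (-u ^ 2 / 2) / √(2 * Real.pi) :=
  intervalIntegral.integral_Ioi_sub_Ioi' integrable_Qfun_density.integrableOn
    integrable_Qfun_density.integrableOn

lemma continuous_Qfun : Continuous Qfun := by
  have h : Qfun = fun x => Qfun 0 - ∫ u in (0 : ℝ)..x, Real.exp (-u ^ 2 / 2) / √(2 * Real.pi) := by
    funext x; rw [← Qfun_sub_Qfun]; ring
  rw [h]
  exact continuous_const.sub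
    (intervalIntegral.continuous_primitive
      (fun _ _ => integrable_Qfun_density.intervalIntegrable) 0)

lemma strictAnti_Qfun : StrictAnti Qfun := by
  intro x y hxy
  rw [← sub_pos, Qfun_sub_Qfun]
  refine intervalIntegral.intervalIntegral_pos_of_pos
    integrable_Qfun_density.intervalIntegrable (fun u => by positivity) hxy

lemma gaussianReal_real_Ici (x : ℝ) : (gaussianReal 0 1).real (Set.Ici x) = Qfun x := by
  have := nullSingletonClass_gaussianReal (μ := 0) (v := 1) one_ne_zero
  rw [Qfun_eq_real]
  exact measureReal_congr Ioi_ae_eq_Ici.symm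

lemma gaussianReal_real_Iio_neg (x : ℝ) : (gaussianReal 0 1).real (Set.Iio (-x)) = Qfun x := by
  have h := gaussianReal_map_neg (μ := 0) (v := 1)
  rw [neg_zero] at h
  rw [Qfun_eq_real]
  conv_lhs => rw [← h]
  rw [map_measureReal_apply measurable_neg measurableSet_Iio]
  congr 1
  ext u; simp

lemma Qfun_zero : Qfun 0 = 1 / 2 := by
  have h1 := gaussianReal_real_Iio_neg 0
  have h2 := gaussianReal_real_Ici 0
  rw [neg_zero] at h1
  have h3 := probReal_add_probReal_compl (μ := gaussianReal 0 1) (measurableSet_Ici (a := (0 : ℝ)))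
  rw [Set.compl_Ici] at h3
  linarith

lemma tendsto_Qfun_atTop : Tendsto Qfun atTop (𝓝 0) := by
  have h : Qfun = fun x => 1 - cdf (gaussianReal 0 1) x := by
    funext x
    rw [cdf_eq_real, Qfun_eq_real, ← Set.compl_Iic, probReal_compl_eq_one_sub measurableSet_Iic]
  rw [h]
  simpa using (tendsto_cdf_atTop (gaussianReal 0 1)).const_sub 1

lemma Qfun_Qinv {y : ℝ} (h0 : 0 < y) (h1 : y < 1 / 2) : Qfun (Qinv y) = y := by
  refine Function.invFun_eq (f := Qfun) ?_
  obtain ⟨b, hb, hb0⟩ := ((tendsto_Qfun_atTop.eventually (gt_mem_nhds h0)).and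
    (eventually_ge_atTop (0 : ℝ))).exists
  obtain ⟨x, -, hx⟩ := intermediate_value_Icc' hb0 continuous_Qfun.continuousOn
    (show y ∈ Set.Icc (Qfun b) (Qfun 0) from ⟨hb.le, by rw [Qfun_zero]; exact h1.le⟩)
  exact ⟨x, hx⟩

lemma Qinv_pos {y : ℝ} (h0 : 0 < y) (h1 : y < 1 / 2) : 0 < Qinv y := by
  rw [← strictAnti_Qfun.lt_iff_gt, Qfun_Qinv h0 h1, Qfun_zero]
  exact h1

/-! ### Covertness forces a positive fraction of light codewords -/

/-- The fraction of message-key pairs whose codeword has weight at most `a`. -/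
noncomputable def lightFrac {N Δ : ℕ} (C : Code n N Δ) (a : ℝ) : ℝ :=
  (1 / ((N : ℝ) * 2 ^ Δ)) * ∑ m : Fin N, ∑ k : BV Δ, if (wt (C.enc m k) : ℝ) ≤ a then (1 : ℝ) else 0

lemma average_le_average {N Δ : ℕ} {f g : Fin N → BV Δ → ℝ} (h : ∀ m k, f m k ≤ g m k) :
    (1 / ((N : ℝ) * 2 ^ Δ)) * ∑ m : Fin N, ∑ k : BV Δ, f m k ≤
      (1 / ((N : ℝ) * 2 ^ Δ)) * ∑ m : Fin N, ∑ k : BV Δ, g m k :=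
  mul_le_mul_of_nonneg_left
    (Finset.sum_le_sum fun m _ => Finset.sum_le_sum fun k _ => h m k) (by positivity)

lemma average_const {N Δ : ℕ} (hN : 0 < N) (c : ℝ) :
    (1 / ((N : ℝ) * 2 ^ Δ)) * ∑ _m : Fin N, ∑ _k : BV Δ, c = c := by
  have : (N : ℝ) ≠ 0 := by positivity
  simp
  field_simp

lemma covertGap_le {N Δ : ℕ} (q : ℝ) (C : Code n N Δ)
    (Φ : BV n → Bool) : covertGap q C ≤ PFA q Φ + PMD q C Φ :=
  ciInf_le (Set.finite_range _).bddBelow Φ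

lemma PFA_eq_prob (q : ℝ) (E : BV n → Prop) [DecidablePred E] :
    PFA q (fun z => decide (E z)) = prob (fun _ => bern q) E := by
  simp only [PFA, prob, noiseP_eq_prodW]
  refine Finset.sum_congr rfl fun z _ => ?_
  by_cases h : E z <;> simp [h]

lemma PMD_eq_average_prob {N Δ : ℕ} (q : ℝ) (C : Code n N Δ) (E : BV n → Prop)
    [DecidablePred E] :
    PMD q C (fun z => decide (E z)) = (1 / ((N : ℝ) * 2 ^ Δ)) * ∑ m : Fin N, ∑ k : BV Δ,
      prob (fun _ => bern q) (fun z => ¬ E (vxor (C.enc m k) z)) := by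
  simp only [PMD]
  congr 1
  refine Finset.sum_congr rfl fun m _ => Finset.sum_congr rfl fun k _ => ?_
  rw [← sum_vxor (C.enc m k), prob]
  refine Finset.sum_congr rfl fun z _ => ?_
  rw [vxor_comm (vxor _ _), vxor_vxor, noiseP_eq_prodW]
  by_cases h : E (vxor (C.enc m k) z) <;> simp [h]

/-- The weight of a shifted noise vector, as centered noise plus drift minus a fluctuation on the
support of the shift. -/
lemma wt_vxor_sub (q : ℝ) (x z : BV n) :
    (wt (vxor x z) : ℝ) - q * n = ∑ i, ((if z i then (1 : ℝ) else 0) - q) + wt x * (1 - 2 * q)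
      - ∑ i, (if x i then 2 * ((if z i then (1 : ℝ) else 0) - q) else 0) := by
  have hn : q * n = ∑ _i : Fin n, q := by simp [mul_comm]
  rw [wt_eq_sum, wt_eq_sum, hn, Finset.sum_mul, ← Finset.sum_sub_distrib, ← Finset.sum_add_distrib,
    ← Finset.sum_sub_distrib]
  refine Finset.sum_congr rfl fun i _ => ?_
  cases hx : x i <;> cases hz : z i <;> simp [vxor, hx, hz] <;> ring

lemma prob_support_fluctuation_le {q κ : ℝ} (h0 : 0 ≤ q) (h1 : q ≤ 1) (hκ : 0 < κ) (x : BV n)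
    (hx : 0 < (wt x : ℝ)) :
    prob (fun _ => bern q) (fun z => κ * wt x <
      ∑ i, (if x i then 2 * ((if z i then (1 : ℝ) else 0) - q) else 0)) ≤
      1 / (κ ^ 2 * wt x) := by
  refine (prob_lt_sum_le (P := fun _ => bern q)
    (f := fun i b => if x i then 2 * ((if b then (1 : ℝ) else 0) - q) else 0)
    (V := wt x) (fun _ => bern_nonneg h0 h1)
    (fun _ => sum_bern q) (fun i => ?_) (by positivity) ?_).trans (le_of_eq ?_)
  · cases x i <;> simp [bern]; ring
  · rw [wt_eq_sum]
    refine Finset.sum_le_sum fun i _ => ?_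
    cases x i <;> simp [bern]
    nlinarith [sq_nonneg (2 * q - 1)]
  · field_simp

lemma prob_missed_le {q κ a s : ℝ} (h0 : 0 ≤ q) (h1 : q ≤ 1) (hκ : 0 < κ)
    (hκq : 0 ≤ 1 - 2 * q - κ) (ha : 0 < a) (hs : 2 * s = a * (1 - 2 * q - κ)) (x : BV n)
    (hx : a < wt x) :
    prob (fun _ : Fin n => bern q) (fun z => ¬ s ≤ (wt (vxor x z) : ℝ) - q * n) ≤
      prob (fun _ : Fin n => bern q) (fun z => ∑ i, ((if z i then (1 : ℝ) else 0) - q) < -s)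
        + 1 / (κ ^ 2 * a) := by
  have hP : ∀ (i : Fin n) b, 0 ≤ bern q b := fun _ => bern_nonneg h0 h1
  refine (prob_le_add hP (G := fun z => κ * wt x <
      ∑ i, (if x i then 2 * ((if z i then (1 : ℝ) else 0) - q) else 0)) fun z hz => ?_).trans
    (add_le_add le_rfl
      ((prob_support_fluctuation_le h0 h1 hκ x (ha.trans hx)).trans ?_))
  · by_contra! hcon
    rw [wt_vxor_sub] at hz
    push Not at hz
    have := mul_le_mul_of_nonneg_right hx.le hκq
    linarith [hcon.1, hcon.2]
  · gcongr

/-- The detector thresholding the weight shows that a covert code has many light codewords. -/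
lemma covertGap_le_prob_add {N Δ : ℕ} {q κ a s : ℝ} (h0 : 0 ≤ q) (h1 : q ≤ 1) (hκ : 0 < κ)
    (hκq : 0 ≤ 1 - 2 * q - κ) (ha : 0 < a) (hs : 2 * s = a * (1 - 2 * q - κ)) (hN : 0 < N)
    (C : Code n N Δ) :
    covertGap q C ≤
      prob (fun _ : Fin n => bern q) (fun z => s ≤ ∑ i, ((if z i then (1 : ℝ) else 0) - q)) +
      (prob (fun _ : Fin n => bern q) (fun z => ∑ i, ((if z i then (1 : ℝ) else 0) - q) < -s)
        + 1 / (κ ^ 2 * a)) + lightFrac C a := by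
  classical
  have hP : ∀ (i : Fin n) b, 0 ≤ bern q b := fun _ => bern_nonneg h0 h1
  refine (covertGap_le q C (fun z => decide (s ≤ (wt z : ℝ) - q * n))).trans ?_
  rw [PFA_eq_prob, PMD_eq_average_prob, add_assoc]
  refine add_le_add (prob_mono hP fun z hz => ?_) ?_
  · rw [wt_eq_sum] at hz
    rwa [Finset.sum_sub_distrib, Finset.sum_const, Finset.card_univ, Fintype.card_fin, nsmul_eq_mul,
      mul_comm (n : ℝ) q]
  · set B := prob (fun _ : Fin n => bern q)
      (fun z => ∑ i, ((if z i then (1 : ℝ) else 0) - q) < -s) + 1 / (κ ^ 2 * a) with hB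
    have hB0 : 0 ≤ B := by
      refine add_nonneg (Finset.sum_nonneg fun z _ => ?_) (by positivity)
      have := prodW_nonneg hP z
      split_ifs <;> simp [this]
    calc _ ≤ (1 / ((N : ℝ) * 2 ^ Δ)) * ∑ m : Fin N, ∑ k : BV Δ,
          (B + if (wt (C.enc m k) : ℝ) ≤ a then (1 : ℝ) else 0) := by
          refine average_le_average fun m k => ?_
          split_ifs with hw
          · exact (prob_le_one hP (fun _ => sum_bern q) _).trans (by linarith)
          · rw [add_zero]
            exact prob_missed_le h0 h1 hκ hκq ha hs _ (not_le.mp hw)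
      _ = B + lightFrac C a := by
          simp only [Finset.sum_add_distrib, mul_add, lightFrac]
          rw [average_const hN]

lemma covertGap_nonneg {n N Δ : ℕ} {q : ℝ} (h0 : 0 ≤ q) (h1 : q ≤ 1) (C : Code n N Δ) :
    0 ≤ covertGap q C := by
  refine Real.iInf_nonneg fun Φ => ?_
  have hnz : ∀ z : BV n, 0 ≤ noiseP q z := fun z => prodW_nonneg (fun _ => bern_nonneg h0 h1) z
  exact add_nonneg (Finset.sum_nonneg fun z _ => mul_nonneg (hnz _) (by split_ifs <;> simp))
    (mul_nonneg (by positivity) (Finset.sum_nonneg fun m _ => Finset.sum_nonneg fun k _ =>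
      Finset.sum_nonneg fun z _ => mul_nonneg (hnz _) (by split_ifs <;> simp)))

/-- Eventually a positive fraction of the codewords has weight at most `c√n`, for any `c` exceeding
the code-weight parameter. -/
lemma exists_lightFrac_ge {q εd c : ℝ} (h0 : 0 < q) (hq2 : q < 1 / 2) (he0 : 0 < εd) (he1 : εd < 1)
    (hc : tpar q εd < c) {N Δ : ℕ → ℕ} {C : ∀ n, Code n (N n) (Δ n)}
    (hcov : IsCovertSeq q εd N Δ C) (hN : ∀ᶠ n in atTop, 0 < N n) :
    ∃ γ > 0, ∀ᶠ n : ℕ in atTop, γ ≤ lightFrac (C n) (c * √n) := by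
  set y := (1 - εd) / 2 with hy
  have hy0 : 0 < y := by rw [hy]; linarith
  have hy1 : y < 1 / 2 := by rw [hy]; linarith
  set σ := √(q * (1 - q)) with hσdef
  have hσ : 0 < σ := Real.sqrt_pos.mpr (mul_pos h0 (by linarith))
  have h2q : 0 < 1 - 2 * q := by linarith
  have hQ := Qinv_pos hy0 hy1
  have ht0 : 0 < tpar q εd := by
    rw [tpar]; exact mul_pos (div_pos (by positivity) h2q) hQ
  have hc0 : 0 < c := ht0.trans hc
  set κ := (1 - 2 * q) * (c - tpar q εd) / (2 * c) with hκdef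
  have hκ : 0 < κ := by
    rw [hκdef]; exact div_pos (mul_pos h2q (by linarith)) (by positivity)
  have hcκ : c * κ = (1 - 2 * q) * (c - tpar q εd) / 2 := by rw [hκdef]; field_simp
  have htq : tpar q εd * (1 - 2 * q) = 2 * σ * Qinv y := by
    rw [tpar]; field_simp; rfl
  set τ := c * (1 - 2 * q - κ) / 2 with hτdef
  have hτ : σ * Qinv y < τ := by
    rw [hτdef]
    nlinarith [mul_pos h2q (sub_pos.mpr hc)]
  have hκq : 0 ≤ 1 - 2 * q - κ := by
    by_contra! hneg
    have := mul_pos hσ hQ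
    nlinarith
  have hQlt : Qfun (τ / σ) < y := by
    rw [← Qfun_Qinv hy0 hy1]
    exact strictAnti_Qfun ((lt_div_iff₀ hσ).mpr (by linarith))
  have hsplit : ∀ (n : ℕ), 1 ≤ n → ∀ z : BV n, ((√n)⁻¹ * ∑ i, stdBit q (z i)) * (σ * √n) =
      ∑ i, ((if z i then (1 : ℝ) else 0) - q) := by
    intro n hn z
    have : 0 < √(n : ℝ) := Real.sqrt_pos.mpr (by exact_mod_cast hn)
    simp only [stdBit, ← Finset.sum_div, ← hσdef]
    field_simp
  have hA : Tendsto (fun n : ℕ => prob (fun _ : Fin n => bern q)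
      (fun z => τ * √n ≤ ∑ i, ((if z i then (1 : ℝ) else 0) - q))) atTop (𝓝 (Qfun (τ / σ))) := by
    have := nullSingletonClass_gaussianReal (μ := 0) (v := 1) one_ne_zero
    have := tendsto_prob_stdBit h0 (by linarith) (measurableSet_Ici (a := τ / σ)) (by simp)
    rw [gaussianReal_real_Ici] at this
    refine this.congr' ?_
    filter_upwards [eventually_ge_atTop 1] with n hn
    have hn0 : 0 < √(n : ℝ) := Real.sqrt_pos.mpr (by exact_mod_cast hn)
    congr 1
    funext z
    have e : τ / σ * (σ * √n) = τ * √n := by field_simp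
    rw [Set.mem_Ici, ← hsplit n hn z, ← mul_le_mul_iff_left₀ (mul_pos hσ hn0), e]
  have hB : Tendsto (fun n : ℕ => prob (fun _ : Fin n => bern q)
      (fun z => ∑ i, ((if z i then (1 : ℝ) else 0) - q) < -(τ * √n))) atTop
      (𝓝 (Qfun (τ / σ))) := by
    have := nullSingletonClass_gaussianReal (μ := 0) (v := 1) one_ne_zero
    have := tendsto_prob_stdBit h0 (by linarith) (measurableSet_Iio (a := -(τ / σ))) (by simp)
    rw [gaussianReal_real_Iio_neg] at this
    refine this.congr' ?_
    filter_upwards [eventually_ge_atTop 1] with n hn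
    have hn0 : 0 < √(n : ℝ) := Real.sqrt_pos.mpr (by exact_mod_cast hn)
    congr 1
    funext z
    have e : -(τ / σ) * (σ * √n) = -(τ * √n) := by field_simp
    rw [Set.mem_Iio, ← hsplit n hn z, ← mul_lt_mul_iff_left₀ (mul_pos hσ hn0), e]
  have hsqrt : Tendsto (fun n : ℕ => √(n : ℝ)) atTop atTop :=
    Real.tendsto_sqrt_atTop.comp tendsto_natCast_atTop_atTop
  have hD : Tendsto (fun n : ℕ => 1 / (κ ^ 2 * (c * √(n : ℝ)))) atTop (𝓝 0) :=
    ((hsqrt.const_mul_atTop hc0).const_mul_atTop (by positivity)).const_div_atTop 1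
  have hsum := hA.add (hB.add hD)
  set γ := (y - Qfun (τ / σ)) / 2 with hγ
  have hγ0 : 0 < γ := by rw [hγ]; linarith
  have e1 := hsum.eventually_lt_const (u := 2 * y - 3 * γ) (by rw [hγ]; linarith)
  have e2 : ∀ᶠ n in atTop, 1 - εd - γ < covertGap q (C n) := by
    refine eventually_lt_of_lt_liminf (lt_of_lt_of_le (by linarith) hcov) ?_
    exact isBoundedUnder_of_eventually_ge (a := 0) (Eventually.of_forall fun n =>
      covertGap_nonneg h0.le (by linarith) (C n))
  refine ⟨γ, hγ0, ?_⟩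
  filter_upwards [e1, e2, hN, eventually_ge_atTop 1] with n h1 h2 hNn hn
  have hn0 : 0 < √(n : ℝ) := Real.sqrt_pos.mpr (by exact_mod_cast hn)
  have := covertGap_le_prob_add (s := τ * √n) h0.le (by linarith) hκ hκq (mul_pos hc0 hn0)
    (by rw [hτdef]; ring) hNn (C n)
  linarith

/-! ### The memoryless jamming attack -/

/-- Probability that the memoryless attack of budget `p` flips a bit, given Alice's bit. -/
noncomputable def flipP (p q : ℝ) (x : Bool) : ℝ := if x then p * (1 - q) / q else p

/-- Distribution of the jamming vector of the memoryless attack, given Alice's transmission. -/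
noncomputable def flipW (p q : ℝ) (x : BV n) (i : Fin n) : Bool → ℝ := bern (flipP p q (x i))

/-- Conditional jamming distribution given James' observation: flip observed ones with probability
`p / q`. -/
noncomputable def jamW (p q : ℝ) (z : BV n) (i : Fin n) : Bool → ℝ :=
  bern (if z i then p / q else 0)

/-- Replace a jamming vector that exceeds the weight budget by the zero vector. -/
noncomputable def truncate (b : ℝ) (s : BV n) : BV n := if (wt s : ℝ) ≤ b then s else fun _ => false

section
variable {p q : ℝ}

lemma flipP_pos (hp : 0 < p) (hpq : p < q) (hq : q < 1) (x : Bool) : 0 < flipP p q x := by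
  cases x
  · simpa [flipP]
  · simp only [flipP, if_true]
    exact div_pos (mul_pos hp (by linarith)) (by linarith)

lemma flipP_lt_one (hp : 0 < p) (hpq : p < q) (hq : q < 1) (x : Bool) : flipP p q x < 1 := by
  cases x
  · simp [flipP]; linarith
  · simp only [flipP, if_true]
    rw [div_lt_one (by linarith)]
    nlinarith

lemma bern_flipP_pos (hp : 0 < p) (hpq : p < q) (hq : q < 1) (x b : Bool) :
    0 < bern (flipP p q x) b := by
  have h1 := flipP_pos hp hpq hq x
  have h2 := flipP_lt_one hp hpq hq x
  cases b <;> simp only [bern, if_true] <;> first | exact h1 | simpa using h2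

lemma flipW_nonneg (hp : 0 < p) (hpq : p < q) (hq : q < 1) (x : BV n) (i : Fin n) (b : Bool) :
    0 ≤ flipW p q x i b := (bern_flipP_pos hp hpq hq _ _).le

lemma sum_flipW (p q : ℝ) (x : BV n) (i : Fin n) : ∑ b, flipW p q x i b = 1 := sum_bern _

lemma jamW_nonneg (hp : 0 < p) (hpq : p < q) (z : BV n) (i : Fin n) (b : Bool) :
    0 ≤ jamW p q z i b := by
  have h1 : 0 ≤ p / q := by have : 0 < q := hp.trans hpq
                            positivity
  have h2 : p / q ≤ 1 := (div_le_one (hp.trans hpq)).mpr hpq.le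
  refine bern_nonneg ?_ ?_ b <;> split_ifs <;> first | assumption | simp

/-- Averaging over James' noise turns the attack into a memoryless channel. -/
lemma sum_noise_mul_jamW (hq : q ≠ 0) (x s : BV n) :
    ∑ z, noiseP q z * prodW (jamW p q (vxor x z)) s = prodW (flipW p q x) s := by
  have h : ∀ z, noiseP q z * prodW (jamW p q (vxor x z)) s =
      prodW (fun i b => bern q b * bern (if (x i ^^ b) then p / q else 0) (s i)) z := by
    intro z
    simp only [noiseP_eq_prodW, prodW, jamW, vxor, Finset.prod_mul_distrib]
    rfl
  simp only [h, sum_prodW]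
  refine Finset.prod_congr rfl fun i _ => ?_
  cases hx : x i <;> cases hs : s i <;> simp [bern, flipW, flipP, hx] <;> field_simp <;> ring

/-- The memoryless attack, truncated to respect James' budget. -/
noncomputable def truncJammer (n : ℕ) {p p' q : ℝ} (hp' : 0 < p') (hpq : p' < q) (hp : 0 ≤ p) :
    Jammer n p where
  W z s := ∑ u : BV n, prodW (jamW p' q z) u * if s = truncate (p * n) u then 1 else 0
  nonneg z s := Finset.sum_nonneg fun u _ =>
    mul_nonneg (prodW_nonneg (jamW_nonneg hp' hpq z) u) (by split_ifs <;> simp)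
  sum_one z := by
    rw [Finset.sum_comm]
    simp only [← Finset.mul_sum]
    simpa using sum_prodW_eq_one (P := jamW p' q z) (fun i => sum_bern _)
  wt_le z s h := by
    by_contra hs
    refine h (Finset.sum_eq_zero fun u _ => ?_)
    have : s ≠ truncate (p * n) u := by
      rintro rfl
      refine hs ?_
      rw [truncate]
      split_ifs with hu
      · exact hu
      · simp [wt]; positivity
    simp [this]

lemma one_sub_le_sum_truncJammer {p' : ℝ} (hp' : 0 < p') (hpq : p' < q) (hq : q < 1) (hp : 0 ≤ p)
    (x : BV n) (D : BV n → Prop) [DecidablePred D] :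
    1 - prob (flipW p' q x) D - prob (flipW p' q x) (fun s => p * n < wt s) ≤
      ∑ z, noiseP q z * ∑ s, (truncJammer n hp' hpq hp).W (vxor x z) s *
        (if D s then (0 : ℝ) else 1) := by
  have h : ∀ z, ∑ s, (truncJammer n hp' hpq hp).W (vxor x z) s * (if D s then (0 : ℝ) else 1) =
      ∑ u, prodW (jamW p' q (vxor x z)) u * (if D (truncate (p * n) u) then (0 : ℝ) else 1) := by
    intro z
    simp only [truncJammer, Finset.sum_mul]
    rw [Finset.sum_comm]
    refine Finset.sum_congr rfl fun u _ => ?_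
    rw [Finset.sum_eq_single (truncate (p * n) u)]
    · simp
    · intro s _ hs; simp [hs]
    · simp
  simp only [h, Finset.mul_sum]
  rw [Finset.sum_comm]
  simp only [← mul_assoc, ← Finset.sum_mul]
  simp only [sum_noise_mul_jamW (hp'.trans hpq).ne']
  conv_lhs => lhs; lhs; rw [← sum_prodW_eq_one (sum_flipW p' q x)]
  rw [prob, prob, ← Finset.sum_sub_distrib,
    ← Finset.sum_sub_distrib]
  refine Finset.sum_le_sum fun u _ => ?_
  have hu := prodW_nonneg (flipW_nonneg hp' hpq hq x) u
  by_cases hw : (wt u : ℝ) ≤ p * n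
  · by_cases hD : D u <;> simp [truncate, hw, hD, not_lt.mpr hw]
  · simp only [not_le.mp hw, if_true]
    split_ifs <;> simp <;> linarith

lemma prob_budget_exceeded_le {p' a : ℝ} (hp' : 0 < p') (hpq : p' < q) (hq : q < 1) (x : BV n)
    (hx : wt x ≤ a) (hpos : 0 < n * (p - p') - a) :
    prob (flipW p' q x) (fun s => p * n < wt s) ≤ n / (n * (p - p') - a) ^ 2 := by
  have hP := flipW_nonneg hp' hpq hq x
  refine (prob_mono hP (fun s hs => ?_)).trans (prob_lt_sum_le hP (sum_flipW p' q x)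
    (f := fun i b => (if b then (1 : ℝ) else 0) - flipP p' q (x i)) (fun i => ?_) hpos ?_)
  · have : ∑ i, flipP p' q (x i) ≤ n * p' + wt x := by
      have hn : n * p' = ∑ _i : Fin n, p' := by simp
      rw [wt_eq_sum, hn, ← Finset.sum_add_distrib]
      refine Finset.sum_le_sum fun i _ => ?_
      have := flipP_lt_one hp' hpq hq (x i)
      cases hxi : x i
      · simp [flipP]
      · rw [hxi] at this; simp; linarith
    rw [Finset.sum_sub_distrib, ← wt_eq_sum]
    linarith
  · simp [flipW, bern]; ring
  · have : (n : ℝ) = ∑ _i : Fin n, (1 : ℝ) := by simp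
    rw [this]
    refine Finset.sum_le_sum fun i _ => ?_
    have h0 := flipP_pos hp' hpq hq (x i)
    have h1 := flipP_lt_one hp' hpq hq (x i)
    simp [flipW, bern]
    nlinarith
end

/-! ### A change-of-measure bound on the decoding regions -/

/-- Log-likelihood ratio, as a function of the flip at a position where Alice sends one, between
the output distributions of the attacked channel for inputs one and zero. -/
noncomputable def llr (p q : ℝ) (s : Bool) : ℝ :=
  Real.log (bern (flipP p q true) s / bern (flipP p q false) (!s))

/-- Weight-normalized information (in nats) conveyed over the attacked channel. -/
noncomputable def infoNat (p q : ℝ) : ℝ := ∑ s, bern (flipP p q true) s * llr p q s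

/-- Variance of the log-likelihood ratio. -/
noncomputable def varNat (p q : ℝ) : ℝ :=
  ∑ s, bern (flipP p q true) s * (llr p q s - infoNat p q) ^ 2

section
variable {p q : ℝ}

lemma infoNat_nonneg (hp : 0 < p) (hpq : p < q) (hq : q < 1) : 0 ≤ infoNat p q := by
  have h : ∀ s, bern (flipP p q true) s - bern (flipP p q false) (!s) ≤
      bern (flipP p q true) s * llr p q s := by
    intro s
    have h1 := bern_flipP_pos hp hpq hq true s
    have h2 := bern_flipP_pos hp hpq hq false (!s)
    have := Real.one_sub_inv_le_log_of_pos (div_pos h1 h2)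
    have := mul_le_mul_of_nonneg_left this h1.le
    refine le_trans (le_of_eq ?_) this
    field_simp
  refine le_trans (le_of_eq ?_) (Finset.sum_le_sum fun s _ => h s)
  simp [bern]

lemma varNat_nonneg (hp : 0 < p) (hpq : p < q) (hq : q < 1) : 0 ≤ varNat p q :=
  Finset.sum_nonneg fun s _ => mul_nonneg (bern_flipP_pos hp hpq hq true s).le (sq_nonneg _)

lemma prodW_flipW_eq_exp (hp : 0 < p) (hpq : p < q) (hq : q < 1) (x s : BV n) :
    prodW (flipW p q x) s = Real.exp (∑ i, if x i then llr p q (s i) else 0) *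
      prodW (fun _ => bern p) (vxor x s) := by
  rw [Real.exp_sum, prodW, prodW, ← Finset.prod_mul_distrib]
  refine Finset.prod_congr rfl fun i _ => ?_
  cases hx : x i
  · simp [flipW, vxor, hx, flipP]
  · have h1 := bern_flipP_pos hp hpq hq true (s i)
    have h2 := bern_flipP_pos hp hpq hq false (!s i)
    have h3 : bern p (!s i) = bern (flipP p q false) (!s i) := rfl
    simp only [flipW, vxor, hx, llr, if_true, Bool.true_xor, h3]
    rw [Real.exp_log (div_pos h1 h2)]
    field_simp

lemma prob_llr_gt_le {a η : ℝ} (hp : 0 < p) (hpq : p < q) (hq : q < 1) (ha : 0 < a) (hη : 0 < η)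
    (x : BV n) (hx : wt x ≤ a) :
    prob (flipW p q x)
      (fun s => a * (infoNat p q + η) < ∑ i, if x i then llr p q (s i) else 0) ≤
      varNat p q / (a * η ^ 2) := by
  have hP := flipW_nonneg hp hpq hq x
  refine (prob_mono hP (fun s hs => ?_)).trans ((prob_lt_sum_le hP (sum_flipW p q x)
    (f := fun i b => if x i then llr p q b - infoNat p q else 0) (fun i => ?_)
    (mul_pos ha hη) (V := a * varNat p q) ?_).trans (le_of_eq ?_))
  · have h : ∑ i, (if x i then llr p q (s i) - infoNat p q else 0) =
        ∑ i, (if x i then llr p q (s i) else 0) - wt x * infoNat p q := by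
      rw [wt_eq_sum, Finset.sum_mul, ← Finset.sum_sub_distrib]
      refine Finset.sum_congr rfl fun i _ => ?_
      cases x i <;> simp
    rw [h]
    have := mul_le_mul_of_nonneg_right hx (infoNat_nonneg hp hpq hq)
    linarith
  · cases hx : x i
    · simp
    · simp only [if_true, mul_sub, Finset.sum_sub_distrib, ← Finset.sum_mul, sum_flipW, one_mul]
      simp only [flipW, hx, infoNat, sub_self]
  · refine le_trans (le_of_eq ?_)
      (mul_le_mul_of_nonneg_right hx (varNat_nonneg hp hpq hq))
    rw [wt_eq_sum, Finset.sum_mul]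
    refine Finset.sum_congr rfl fun i _ => ?_
    cases hx : x i
    · simp
    · simp [flipW, hx, varNat]
  · field_simp

lemma prob_decode_le {a η : ℝ} (hp : 0 < p) (hpq : p < q) (hq : q < 1) (ha : 0 < a) (hη : 0 < η)
    (x : BV n) (hx : wt x ≤ a) (D : BV n → Prop) [DecidablePred D] :
    prob (flipW p q x) (fun s => D (vxor x s)) ≤ varNat p q / (a * η ^ 2) +
      Real.exp (a * (infoNat p q + η)) * ∑ y, if D y then prodW (fun _ => bern p) y else 0 := by
  refine le_trans ?_ (add_le_add (prob_llr_gt_le hp hpq hq ha hη x hx) le_rfl)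
  rw [← sum_vxor x, Finset.mul_sum, prob, prob, ← Finset.sum_add_distrib]
  refine Finset.sum_le_sum fun s _ => ?_
  have h0 := prodW_nonneg (flipW_nonneg hp hpq hq x) s
  have h1 : 0 ≤ prodW (fun _ => bern p) (vxor x s) :=
    prodW_nonneg (fun _ => bern_nonneg hp.le (by linarith)) _
  by_cases hD : D (vxor x s)
  · simp only [hD, if_true]
    split_ifs with hL
    · have := mul_nonneg (Real.exp_pos (a * (infoNat p q + η))).le h1
      linarith
    · rw [zero_add, prodW_flipW_eq_exp hp hpq hq]
      gcongr
      exact not_lt.mp hL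
  · simp only [hD, if_false, mul_zero, add_zero]
    split_ifs <;> simp [h0]

lemma sum_decode_le_one {N : ℕ} (hp : 0 ≤ p) (hp1 : p ≤ 1) (d : BV n → Option (Fin N)) :
    ∑ m, ∑ y, (if d y = some m then prodW (fun _ : Fin n => bern p) y else 0) ≤ 1 := by
  rw [Finset.sum_comm, ← sum_prodW_eq_one (P := fun _ : Fin n => bern p) (fun _ => sum_bern p)]
  refine Finset.sum_le_sum fun y _ => ?_
  have h := prodW_nonneg (P := fun _ : Fin n => bern p) (fun _ => bern_nonneg hp hp1) y
  rcases hd : d y with _ | m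
  · simpa using h
  · simp

lemma errSilent_nonneg {N Δ : ℕ} (h0 : 0 ≤ q) (h1 : q ≤ 1) (C : Code n N Δ) (J : Jammer n p) :
    0 ≤ errSilent q C J := by
  have hnz : ∀ z : BV n, 0 ≤ noiseP q z := fun z => prodW_nonneg (fun _ => bern_nonneg h0 h1) z
  exact mul_nonneg (by positivity) (Finset.sum_nonneg fun k _ => Finset.sum_nonneg fun z _ =>
    mul_nonneg (hnz z) (Finset.sum_nonneg fun s _ =>
      mul_nonneg (J.nonneg _ _) (by split_ifs <;> simp)))

lemma sum_noise_mul_kernel_le_one (h0 : 0 ≤ q) (h1 : q ≤ 1) (J : Jammer n p)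
    (f : BV n → BV n) (g : BV n → ℝ) (hg : ∀ s, g s ≤ 1) :
    ∑ z : BV n, noiseP q z * ∑ s, J.W (f z) s * g s ≤ 1 := by
  have hnz : ∀ z : BV n, 0 ≤ noiseP q z := fun z => prodW_nonneg (fun _ => bern_nonneg h0 h1) z
  calc _ ≤ ∑ z : BV n, noiseP q z * 1 := by
        refine Finset.sum_le_sum fun z _ => mul_le_mul_of_nonneg_left ?_ (hnz z)
        rw [← J.sum_one (f z)]
        exact Finset.sum_le_sum fun s _ => mul_le_of_le_one_right (J.nonneg _ _) (hg s)
    _ = 1 := by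
        simp only [mul_one]
        exact sum_prodW_eq_one (P := fun _ : Fin n => bern q) (fun _ => sum_bern q)

lemma errActive_le_Perr {N Δ : ℕ} (h0 : 0 ≤ q) (h1 : q ≤ 1) (hN : 0 < N) (C : Code n N Δ)
    (J : Jammer n p) : errActive q C J ≤ Perr p q C := by
  have hbdd : BddAbove (Set.range fun J : Jammer n p => errSilent q C J + errActive q C J) := by
    refine ⟨1 + 1, ?_⟩
    rintro _ ⟨J, rfl⟩
    refine add_le_add ?_ ?_
    · calc errSilent q C J ≤ (1 / (2 ^ Δ : ℝ)) * ∑ _k : BV Δ, 1 :=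
            mul_le_mul_of_nonneg_left (Finset.sum_le_sum fun k _ =>
              sum_noise_mul_kernel_le_one h0 h1 J id _ fun s => by split_ifs <;> simp)
              (by positivity)
        _ = 1 := by simp
    · calc errActive q C J ≤ (1 / ((N : ℝ) * 2 ^ Δ)) * ∑ _m : Fin N, ∑ _k : BV Δ, 1 :=
            average_le_average fun m k =>
              sum_noise_mul_kernel_le_one h0 h1 J (vxor (C.enc m k)) _ fun s => by
                split_ifs <;> simp
        _ = 1 := average_const hN 1
  have := le_ciSup hbdd J
  have := errSilent_nonneg h0 h1 C J
  rw [Perr]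
  linarith

/-- The converse bound: the error probability under the truncated memoryless attack. -/
lemma lightFrac_mul_sub_le_Perr {p' a η : ℝ} {N Δ : ℕ} (hp : 0 < p) (hp' : 0 < p') (hpq : p' < q)
    (hq : q < 1) (ha : 0 < a) (hη : 0 < η) (hpos : 0 < n * (p - p') - a) (hN : 0 < N)
    (C : Code n N Δ) :
    lightFrac C a * (1 - varNat p' q / (a * η ^ 2) - n / (n * (p - p') - a) ^ 2)
      - Real.exp (a * (infoNat p' q + η)) / N ≤ Perr p q C := by
  have h0 : 0 ≤ q := by linarith
  refine le_trans ?_ (errActive_le_Perr h0 hq.le hN C (truncJammer n hp' hpq hp.le))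
  set δ := varNat p' q / (a * η ^ 2)
  set β := n / (n * (p - p') - a) ^ 2
  set T := Real.exp (a * (infoNat p' q + η))
  set Q : Fin N → BV Δ → ℝ := fun m k =>
    ∑ y, if C.dec y k = some m then prodW (fun _ : Fin n => bern p') y else 0 with hQ
  have hQ0 : ∀ m k, 0 ≤ Q m k := fun m k => Finset.sum_nonneg fun y _ => by
    have := prodW_nonneg (P := fun _ : Fin n => bern p')
      (fun _ => bern_nonneg hp'.le (by linarith)) y
    split_ifs <;> simp [this]
  have key : ∀ m k, (if (wt (C.enc m k) : ℝ) ≤ a then (1 : ℝ) else 0) * (1 - δ - β) - T * Q m k ≤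
      ∑ zb : BV n, noiseP q zb * ∑ s : BV n,
        (truncJammer n hp' hpq hp.le).W (vxor (C.enc m k) zb) s *
          (if C.dec (vxor (C.enc m k) s) k = some m then (0 : ℝ) else 1) := by
    intro m k
    split_ifs with hw
    · have h1 := one_sub_le_sum_truncJammer hp' hpq hq hp.le (C.enc m k)
        (fun s => C.dec (vxor (C.enc m k) s) k = some m)
      have h2 := prob_budget_exceeded_le (p := p) hp' hpq hq (C.enc m k) hw hpos
      have h3 := prob_decode_le hp' hpq hq ha hη (C.enc m k) hw (fun y => C.dec y k = some m)
      simp only [hQ]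
      linarith
    · have h1 : 0 ≤ ∑ zb : BV n, noiseP q zb * ∑ s : BV n,
          (truncJammer n hp' hpq hp.le).W (vxor (C.enc m k) zb) s *
            (if C.dec (vxor (C.enc m k) s) k = some m then (0 : ℝ) else 1) :=
        Finset.sum_nonneg fun z _ => mul_nonneg
          (prodW_nonneg (fun _ => bern_nonneg h0 hq.le) z) (Finset.sum_nonneg fun s _ =>
            mul_nonneg ((truncJammer n hp' hpq hp.le).nonneg _ _) (by split_ifs <;> simp))
      have := mul_nonneg (Real.exp_pos (a * (infoNat p' q + η))).le (hQ0 m k)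
      linarith
  refine le_trans ?_ (average_le_average key)
  simp only [Finset.sum_sub_distrib, ← Finset.sum_mul, ← Finset.mul_sum, mul_sub (1 / _ : ℝ)]
  rw [← mul_assoc (1 / ((N : ℝ) * 2 ^ Δ))]
  refine sub_le_sub (le_of_eq (by rw [lightFrac])) ?_
  have hsum : ∑ m, ∑ k, Q m k ≤ 2 ^ Δ := by
    rw [Finset.sum_comm]
    calc _ ≤ ∑ _k : BV Δ, (1 : ℝ) := Finset.sum_le_sum fun k _ =>
          sum_decode_le_one hp'.le (by linarith) (fun y => C.dec y k)
      _ = 2 ^ Δ := by simp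
  have hN' : (0 : ℝ) < N := by exact_mod_cast hN
  calc (1 / ((N : ℝ) * 2 ^ Δ)) * (T * ∑ m, ∑ k, Q m k) ≤ (1 / ((N : ℝ) * 2 ^ Δ)) * (T * 2 ^ Δ) := by
        gcongr
    _ = T / N := by field_simp
end

/-! ### Passing to the limit -/

lemma infoNat_eq_IB {p q : ℝ} (hp : 0 < p) (hpq : p < q) (hq : q < 1) :
    infoNat p q = IB p q * Real.log 2 := by
  have hq0 : 0 < q := hp.trans hpq
  have hq1 : 0 < 1 - q := by linarith
  have hp1 : 0 < 1 - p := by linarith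
  have hu : 0 < q - p + p * q := by nlinarith [mul_pos hp hq0]
  have h2 : Real.log 2 ≠ 0 := (Real.log_pos one_lt_two).ne'
  have e1 : 1 - p * (1 - q) / q = (q - p + p * q) / q := by field_simp; ring
  simp only [infoNat, llr, IB, Fintype.sum_bool, bern, flipP, Real.logb, if_true, Bool.not_true,
    Bool.not_false, Bool.false_eq_true, if_false, e1]
  rw [Real.log_div (by positivity) (by positivity), Real.log_div (by positivity) (by positivity),
    Real.log_div (by positivity) (by positivity), Real.log_div (by positivity) (by positivity),
    Real.log_div (by positivity) (by positivity), Real.log_div (by positivity) (by positivity),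
    Real.log_mul (by positivity) (by positivity), Real.log_mul (by positivity) (by positivity),
    Real.log_mul (by positivity) (by positivity), Real.log_mul (by positivity) (by positivity),
    Real.log_pow]
  field_simp
  push_cast
  ring

lemma continuousAt_infoNat {p q : ℝ} (hp : 0 < p) (hpq : p < q) (hq : q < 1) :
    ContinuousAt (fun p => infoNat p q) p := by
  have hq0 : 0 < q := hp.trans hpq
  have h1 := fun s => (bern_flipP_pos hp hpq hq true s).ne'
  have h2 := fun s => (bern_flipP_pos hp hpq hq false s).ne'
  have h : ∀ x s, ContinuousAt (fun p => bern (flipP p q x) s) p := by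
    intro x s
    cases x <;> cases s <;> simp [bern, flipP] <;> fun_prop
  unfold infoNat llr
  exact tendsto_finsetSum _ fun s _ => (h true s).mul
    (((h true s).div (h false (!s)) (h2 _)).log (div_ne_zero (h1 s) (h2 _)))

lemma covertGap_nonpos_of_eq_zero {n N Δ : ℕ} (q : ℝ) (hN : N = 0) (C : Code n N Δ) :
    covertGap q C ≤ 0 :=
  (covertGap_le q C fun _ => false).trans (by simp [PFA, PMD, hN])

lemma eventually_pos_of_isCovertSeq {q εd : ℝ} (h0 : 0 ≤ q) (h1 : q ≤ 1) (he1 : εd < 1)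
    {N Δ : ℕ → ℕ} {C : ∀ n, Code n (N n) (Δ n)} (hcov : IsCovertSeq q εd N Δ C) :
    ∀ᶠ n in atTop, 0 < N n := by
  have h : ∀ᶠ n in atTop, 0 < covertGap q (C n) :=
    eventually_lt_of_lt_liminf (lt_of_lt_of_le (by linarith) hcov)
      (isBoundedUnder_of_eventually_ge (a := 0) (Eventually.of_forall fun n =>
        covertGap_nonneg h0 h1 (C n)))
  filter_upwards [h] with n hn
  exact Nat.pos_of_ne_zero fun hz => hn.not_ge (covertGap_nonpos_of_eq_zero q hz (C n))

lemma tendsto_natCast_div_sq {b c : ℝ} (hb : 0 < b) :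
    Tendsto (fun n : ℕ => (n : ℝ) / (n * b - c * √n) ^ 2) atTop (𝓝 0) := by
  have hsqrt : Tendsto (fun n : ℕ => √(n : ℝ)) atTop atTop :=
    Real.tendsto_sqrt_atTop.comp tendsto_natCast_atTop_atTop
  have h : Tendsto (fun n : ℕ => √(n : ℝ) * b - c) atTop atTop :=
    tendsto_atTop_add_const_right _ _ (hsqrt.atTop_mul_const hb)
  refine (((tendsto_pow_atTop two_ne_zero).comp h).const_div_atTop 1).congr' ?_
  filter_upwards [eventually_ge_atTop 1] with n hn
  have hn0 : 0 < √(n : ℝ) := Real.sqrt_pos.mpr (by exact_mod_cast hn)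
  have e : (n : ℝ) * b - c * √n = √n * (√n * b - c) := by
    nth_rewrite 1 [← Real.mul_self_sqrt n.cast_nonneg]
    ring
  rw [e, mul_pow, Real.sq_sqrt n.cast_nonneg, Function.comp_apply, ← div_div,
    div_self (by positivity)]

lemma tendsto_mul_sub_sqrt {b c : ℝ} (hb : 0 < b) :
    Tendsto (fun n : ℕ => (n : ℝ) * b - c * √n) atTop atTop := by
  have hsqrt : Tendsto (fun n : ℕ => √(n : ℝ)) atTop atTop :=
    Real.tendsto_sqrt_atTop.comp tendsto_natCast_atTop_atTop
  have h : Tendsto (fun n : ℕ => √(n : ℝ) * b - c) atTop atTop :=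
    tendsto_atTop_add_const_right _ _ (hsqrt.atTop_mul_const hb)
  refine (hsqrt.atTop_mul_atTop₀ h).congr fun n => ?_
  nth_rewrite 3 [← Real.mul_self_sqrt n.cast_nonneg]
  ring

/-- The converse for a fixed attack parameter `p' < p` and weight constant `c > t(q, εd)`. -/
lemma mul_log_two_le_of_achievable {p p' q εd c η r : ℝ} (hp' : 0 < p') (hp : p' < p)
    (hpq : p' < q) (hq2 : q < 1 / 2) (he0 : 0 < εd) (he1 : εd < 1) (hc0 : 0 < c)
    (hc : tpar q εd < c) (hη : 0 < η) {Δ : ℕ → ℕ} (h : Achievable p q εd Δ r) :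
    r * Real.log 2 ≤ c * (infoNat p' q + η) := by
  obtain ⟨N, C, hcov, hr, herr⟩ := h
  have h0 : 0 < q := hp'.trans hpq
  have hN := eventually_pos_of_isCovertSeq h0.le (by linarith) he1 hcov
  obtain ⟨γ, hγ, hlight⟩ := exists_lightFrac_ge h0 hq2 he0 he1 hc hcov hN
  have hb : 0 < p - p' := sub_pos.mpr hp
  have hsqrt : Tendsto (fun n : ℕ => √(n : ℝ)) atTop atTop :=
    Real.tendsto_sqrt_atTop.comp tendsto_natCast_atTop_atTop
  have hvar : Tendsto (fun n : ℕ => varNat p' q / (c * √n * η ^ 2)) atTop (𝓝 0) :=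
    ((hsqrt.const_mul_atTop hc0).atTop_mul_const (by positivity)).const_div_atTop _
  have hlim : Tendsto (fun n : ℕ => c * (infoNat p' q + η) + Real.log (4 / γ) / √n) atTop
      (𝓝 (c * (infoNat p' q + η))) := by
    simpa using (hsqrt.const_div_atTop (Real.log (4 / γ))).const_add (c * (infoNat p' q + η))
  refine ge_of_tendsto hlim ?_
  filter_upwards [hN, hlight, hvar.eventually_lt_const (u := 1 / 4) (by norm_num),
    (tendsto_natCast_div_sq (c := c) hb).eventually_lt_const (u := 1 / 4) (by norm_num),
    (tendsto_mul_sub_sqrt (c := c) hb).eventually_gt_atTop 0,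
    herr.eventually_lt_const (u := γ / 4) (by positivity), eventually_ge_atTop 1]
    with n hNn hl hv hd hpos he hn
  have hn0 : 0 < √(n : ℝ) := Real.sqrt_pos.mpr (by exact_mod_cast hn)
  have hN0 : (0 : ℝ) < N n := by exact_mod_cast hNn
  have hmain := lightFrac_mul_sub_le_Perr (hp'.trans hp) hp' hpq (by linarith)
    (mul_pos hc0 hn0) hη hpos hNn (C n)
  set A := c * √n * (infoNat p' q + η) with hA
  have hexp : γ / 4 ≤ Real.exp A / N n := by
    have : γ * (1 / 2) ≤ lightFrac (C n) (c * √n) *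
        (1 - varNat p' q / (c * √n * η ^ 2) - n / (n * (p - p') - c * √n) ^ 2) :=
      mul_le_mul hl (by linarith) (by norm_num) (hγ.le.trans hl)
    linarith
  have hlog : Real.log (N n) ≤ A + Real.log (4 / γ) := by
    rw [← Real.log_exp A, ← Real.log_mul (Real.exp_pos _).ne' (by positivity)]
    refine Real.log_le_log hN0 ?_
    rw [le_div_iff₀ hN0] at hexp
    rw [mul_div_assoc', le_div_iff₀ hγ]
    linarith
  have h2 : 0 < Real.log 2 := Real.log_pos one_lt_two
  calc r * Real.log 2 ≤ Real.logb 2 (N n) / √n * Real.log 2 :=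
        mul_le_mul_of_nonneg_right (hr n hn) h2.le
    _ = Real.log (N n) / √n := by rw [Real.logb]; field_simp
    _ ≤ (A + Real.log (4 / γ)) / √n := by gcongr
    _ = c * (infoNat p' q + η) + Real.log (4 / γ) / √n := by rw [hA]; field_simp

lemma tpar_pos {q εd : ℝ} (h0 : 0 < q) (hq2 : q < 1 / 2) (he0 : 0 < εd) (he1 : εd < 1) :
    0 < tpar q εd :=
  mul_pos (div_pos (mul_pos two_pos (Real.sqrt_pos.mpr (mul_pos h0 (by linarith)))) (by linarith))
    (Qinv_pos (by linarith) (by linarith))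

lemma le_tpar_mul_IB_of_achievable {p q εd r : ℝ} (hp : 0 < p) (hpq : p < q) (hq2 : q < 1 / 2)
    (he0 : 0 < εd) (he1 : εd < 1) {Δ : ℕ → ℕ} (h : Achievable p q εd Δ r) :
    r ≤ tpar q εd * IB p q := by
  have h2 : 0 < Real.log 2 := Real.log_pos one_lt_two
  have ht := tpar_pos (hp.trans hpq) hq2 he0 he1
  have hcont : ContinuousAt (fun s => (tpar q εd + s) * (infoNat (p - s) q + s)) 0 := by
    have : ContinuousAt (fun s => infoNat (p - s) q) 0 :=
      ContinuousAt.comp (g := fun p => infoNat p q) (f := fun s => p - s)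
        (by simpa using continuousAt_infoNat hp hpq (by linarith)) (by fun_prop)
    fun_prop
  have hlim := hcont.tendsto.mono_left (nhdsWithin_le_nhds (s := Set.Ioi 0))
  rw [add_zero, sub_zero, add_zero] at hlim
  have hle : r * Real.log 2 ≤ tpar q εd * infoNat p q := by
    refine ge_of_tendsto hlim ?_
    filter_upwards [Ioo_mem_nhdsGT hp] with s hs
    exact mul_log_two_le_of_achievable (by linarith [hs.2]) (by linarith [hs.1])
      (by linarith [hs.1]) hq2 he0 he1 (by linarith [hs.1]) (by linarith [hs.1]) hs.1 h
  rw [infoNat_eq_IB hp hpq (by linarith), ← mul_assoc] at hle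
  exact le_of_mul_le_mul_right hle h2

end

end CovertComm

namespace CovertComm

/-- Theorem 2, part 2.  If `0 < p < q < 1/2` and
`εd ∈ (0,1)`, then for every sequence of key sizes `Δ(n)`, every achievable
relative throughput `r` satisfies `r ≤ t(q,εd) · I_B(p,q)`. -/
theorem covert_capacity_upper_bound (p q εd : ℝ)
    (hp0 : 0 < p) (hpq : p < q) (hq2 : q < 1 / 2)
    (he0 : 0 < εd) (he1 : εd < 1) :
    ∀ (Δ : ℕ → ℕ) (r : ℝ), Achievable p q εd Δ r → r ≤ tpar q εd * IB p q := by
  intro Δ r h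
  exact le_tpar_mul_IB_of_achievable hp0 hpq hq2 he0 he1 h

end CovertComm
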